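/- For every integer A ≥ 2 and positive reals α₁, …, α_A with Ā = Σᵢ αᵢ, the second moment of the entropy of a Dirichlet(α₁,…,α_A) random vector satisfies: (1/Z) ∫_{T_A} (−Σᵢ πᵢ(x) log πᵢ(x))² ∏ⱼ πⱼ(x)^{αⱼ−1} dx = Σ_{i≠k} (αᵢ αₖ / ((Ā+1) Ā)) · I_{ik} + Σᵢ (αᵢ(αᵢ+1) / ((Ā+1) Ā)) · Jᵢ, where Z = ∏ⱼ Γ(αⱼ)/Γ(Ā), I_{ik} = (ψ₀(αₖ+1) − ψ₀(Ā+2))(ψ₀(αᵢ+1) − ψ₀(Ā+2)) − ψ₁(Ā+2), and Jᵢ = (ψ₀(αᵢ+2) − ψ₀(Ā+2))² + ψ₁(αᵢ+2) − ψ₁(Ā+2). -/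

import Mathlib

open MeasureTheory Real Finset

/-- The digamma function `ψ₀(x) = d/dx log Γ(x)`. -/
noncomputable def digamma (x : ℝ) : ℝ := deriv (fun y => Real.log (Real.Gamma y)) x

/-- The trigamma function `ψ₁ = ψ₀′`. -/
noncomputable def trigamma (x : ℝ) : ℝ := deriv digamma x

/-- The simplex coordinates: for `x ∈ ℝ^{A−1}`, `π i x = x i` for `i < A − 1` and
`π (A-1) x = 1 − ∑ x j`. -/
noncomputable def simplexCoord (A : ℕ) (x : Fin (A - 1) → ℝ) (i : Fin A) : ℝ :=
  if h : (i : ℕ) < A - 1 then x ⟨i, h⟩ else 1 - ∑ j, x j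

/-- The solid simplex `T_A = {x ∈ ℝ^{A−1} : xᵢ ≥ 0, ∑ xᵢ ≤ 1}`. -/
def solidSimplex (A : ℕ) : Set (Fin (A - 1) → ℝ) :=
  {x | (∀ i, 0 ≤ x i) ∧ ∑ i, x i ≤ 1}

/-- The density `x ^ (s - 1) / Γ(s)` of the Riemann–Liouville kernel on `(0, ∞)`, extended by zero. -/
noncomputable def rieszKernel (s x : ℝ) : ENNReal :=
  ENNReal.ofReal (if 0 < x then x ^ (s - 1) / Real.Gamma s else 0)

lemma rieszKernel_of_pos {s x : ℝ} (hx : 0 < x) :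
    rieszKernel s x = ENNReal.ofReal (x ^ (s - 1) / Real.Gamma s) := by
  simp [rieszKernel, hx]

lemma rieszKernel_of_nonpos {s x : ℝ} (hx : x ≤ 0) : rieszKernel s x = 0 := by
  simp [rieszKernel, hx.not_gt]

@[fun_prop]
lemma measurable_rieszKernel (s : ℝ) : Measurable (rieszKernel s) :=
  (Measurable.ite measurableSet_Ioi (by fun_prop) (by fun_prop)).ennreal_ofReal

lemma lintegral_comp_div_of_pos {r : ℝ} (hr : 0 < r) (f : ℝ → ENNReal) :
    ∫⁻ x, f (x / r) = ENNReal.ofReal r * ∫⁻ x, f x := by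
  have h := (Homeomorph.mulRight₀ r⁻¹ (inv_ne_zero hr.ne')).measurableEmbedding.lintegral_map
    (μ := volume) f
  simp only [Homeomorph.coe_mulRight₀, Real.map_volume_mul_right (inv_ne_zero hr.ne'), inv_inv,
    abs_of_pos hr, lintegral_smul_measure, smul_eq_mul] at h
  simp only [div_eq_mul_inv]
  exact h.symm

/-- The kernels `x ^ (s - 1) / Γ(s)` form a convolution semigroup. -/
lemma lintegral_rieszKernel_mul {s t : ℝ} (hs : 0 < s) (ht : 0 < t) (r : ℝ) :
    ∫⁻ x, rieszKernel s x * rieszKernel t (r - x) = rieszKernel (s + t) r := by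
  rcases le_or_gt r 0 with hr | hr
  · rw [rieszKernel_of_nonpos hr, lintegral_eq_zero_iff (by fun_prop)]
    refine .of_forall fun x => ?_
    rcases le_or_gt x 0 with hx | hx
    · simp [rieszKernel_of_nonpos hx]
    · simp [rieszKernel_of_nonpos (show r - x ≤ 0 by linarith)]
  have hΓs := Real.Gamma_pos_of_pos hs
  have hΓt := Real.Gamma_pos_of_pos ht
  have hΓ := Real.Gamma_pos_of_pos (add_pos hs ht)
  have key : ∀ x, rieszKernel s x * rieszKernel t (r - x) =
      ENNReal.ofReal (r ^ (s + t - 2) / Real.Gamma (s + t)) *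
        ProbabilityTheory.betaPDF s t (x / r) := by
    intro x
    rcases le_or_gt x 0 with hx | hx
    · rw [rieszKernel_of_nonpos hx, ProbabilityTheory.betaPDF_eq_zero_of_nonpos
        (div_nonpos_of_nonpos_of_nonneg hx hr.le)]
      simp
    rcases le_or_gt r x with hxr | hxr
    · rw [rieszKernel_of_nonpos (show r - x ≤ 0 by linarith),
        ProbabilityTheory.betaPDF_eq_zero_of_one_le ((one_le_div hr).2 hxr)]
      simp
    have h1 : 0 < r - x := by linarith
    rw [rieszKernel_of_pos hx, rieszKernel_of_pos h1,
      ProbabilityTheory.betaPDF_of_pos_lt_one (by positivity) ((div_lt_one hr).2 hxr),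
      ← ENNReal.ofReal_mul (by positivity), ← ENNReal.ofReal_mul (by positivity)]
    congr 1
    rw [show 1 - x / r = (r - x) / r by field_simp, Real.div_rpow hx.le hr.le,
      Real.div_rpow h1.le hr.le, show s + t - 2 = (s - 1) + (t - 1) by ring, Real.rpow_add hr,
      ProbabilityTheory.beta]
    field_simp
  simp_rw [key]
  rw [lintegral_const_mul' _ _ ENNReal.ofReal_ne_top, lintegral_comp_div_of_pos hr,
    ProbabilityTheory.lintegral_betaPDF_eq_one hs ht, mul_one,
    ← ENNReal.ofReal_mul (by positivity), rieszKernel_of_pos hr]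
  congr 1
  rw [show s + t - 1 = (s + t - 2) + 1 by ring, Real.rpow_add hr, Real.rpow_one]
  ring

/-- Dirichlet's integral in convolution form. -/
lemma lintegral_prod_rieszKernel {n : ℕ} (β : Fin n → ℝ) (hβ : ∀ i, 0 < β i) {b : ℝ} (hb : 0 < b)
    (r : ℝ) :
    ∫⁻ x : Fin n → ℝ, (∏ i, rieszKernel (β i) (x i)) * rieszKernel b (r - ∑ i, x i) =
      rieszKernel (∑ i, β i + b) r := by
  induction n generalizing r with
  | zero => simp [volume_pi]
  | succ n ih =>
    have e := volume_preserving_piFinSuccAbove (fun _ : Fin (n + 1) => ℝ) 0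
    rw [← e.symm.lintegral_comp_emb (MeasurableEquiv.measurableEmbedding _),
      Measure.volume_eq_prod, lintegral_prod _ (by fun_prop)]
    simp only [MeasurableEquiv.piFinSuccAbove_symm_apply, Fin.insertNthEquiv_zero,
      Fin.consEquiv_apply, Fin.prod_univ_succ, Fin.sum_univ_succ, Fin.cons_zero, Fin.cons_succ,
      mul_assoc, ← sub_sub]
    have h0 := fun x : ℝ => ih (fun i => β i.succ) (fun i => hβ _) (r - x)
    have hm : ∀ x : ℝ, Measurable fun y : Fin n → ℝ =>
        (∏ i, rieszKernel (β i.succ) (y i)) * rieszKernel b (r - x - ∑ i, y i) := by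
      intro x; fun_prop
    simp_rw [lintegral_const_mul _ (hm _), h0]
    rw [lintegral_rieszKernel_mul (hβ 0)
      (add_pos_of_nonneg_of_pos (Finset.sum_nonneg fun i _ => (hβ _).le) hb), add_assoc]

lemma ae_sum_ne {n : ℕ} (hn : 0 < n) (c : ℝ) : ∀ᵐ x : Fin n → ℝ, ∑ i, x i ≠ c := by
  obtain ⟨m, rfl⟩ : ∃ m, n = m + 1 := ⟨n - 1, by omega⟩
  let f : (Fin (m + 1) → ℝ) →ₗ[ℝ] ℝ := ∑ i, LinearMap.proj i
  have hf : Function.Surjective f := fun y => ⟨Pi.single 0 y, by simp [f]⟩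
  have h := (ae_comp_linearMap_mem_iff f volume volume hf
    (measurableSet_singleton c).compl).2 (Measure.ae_ne volume c)
  simpa [f] using h

lemma simplexCoord_succ {n : ℕ} (x : Fin n → ℝ) (i : Fin (n + 1)) :
    simplexCoord (n + 1) x i = Fin.snoc (α := fun _ => ℝ) x (1 - ∑ j, x j) i := by
  rcases Fin.eq_castSucc_or_eq_last i with ⟨j, rfl⟩ | rfl
  · rw [Fin.snoc_castSucc, simplexCoord]
    exact dif_pos (by simp)
  · rw [Fin.snoc_last, simplexCoord]
    exact dif_neg (by simp)

lemma measurable_simplexCoord (A : ℕ) (i : Fin A) : Measurable fun x => simplexCoord A x i := by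
  unfold simplexCoord
  split_ifs <;> fun_prop

lemma measurableSet_solidSimplex (A : ℕ) : MeasurableSet (solidSimplex A) := by
  simp only [solidSimplex, Set.ofPred_and, Set.ofPred_forall]
  exact (MeasurableSet.iInter fun i =>
    measurableSet_le measurable_const (measurable_pi_apply i)).inter
      (measurableSet_le (by fun_prop) measurable_const)

/-- Almost every point of the solid simplex has positive coordinates. -/
lemma ae_simplexCoord_pos {A : ℕ} (hA : 2 ≤ A) :
    ∀ᵐ x ∂volume.restrict (solidSimplex A), ∀ i, 0 < simplexCoord A x i := by
  obtain ⟨n, rfl⟩ : ∃ n, A = n + 1 := ⟨A - 1, by omega⟩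
  rw [ae_restrict_iff' (measurableSet_solidSimplex _)]
  have h1 : ∀ᵐ x : Fin n → ℝ, ∀ i, x i ≠ 0 :=
    ae_all_iff.2 fun i => Measure.ae_eval_ne (fun _ : Fin n => (volume : Measure ℝ)) i 0
  filter_upwards [h1, ae_sum_ne (n := n) (by omega) 1] with x hx hx1 hmem i
  rw [simplexCoord_succ]
  rcases Fin.eq_castSucc_or_eq_last i with ⟨j, rfl⟩ | rfl
  · rw [Fin.snoc_castSucc]
    exact (hmem.1 j).lt_of_ne' (hx j)
  · rw [Fin.snoc_last]
    exact sub_pos.2 (hmem.2.lt_of_ne hx1)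

/-- The multivariate beta function, the normalising constant of the Dirichlet distribution. -/
noncomputable def multivariateBeta {ι : Type*} [Fintype ι] (β : ι → ℝ) : ℝ :=
  (∏ j, Real.Gamma (β j)) / Real.Gamma (∑ j, β j)

/-- Dirichlet's integral formula. -/
lemma lintegral_solidSimplex_prod_rpow {A : ℕ} (hA : 2 ≤ A) (β : Fin A → ℝ) (hβ : ∀ i, 0 < β i) :
    ∫⁻ x in solidSimplex A, ENNReal.ofReal (∏ j, simplexCoord A x j ^ (β j - 1)) =
      ENNReal.ofReal (multivariateBeta β) := by
  obtain ⟨n, rfl⟩ : ∃ n, A = n + 1 := ⟨A - 1, by omega⟩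
  have hΓ : ∀ j, 0 < Real.Gamma (β j) := fun j => Real.Gamma_pos_of_pos (hβ j)
  have hP : 0 ≤ ∏ j, Real.Gamma (β j) := Finset.prod_nonneg fun j _ => (hΓ j).le
  have hpos := (ae_restrict_iff' (measurableSet_solidSimplex _)).1 (ae_simplexCoord_pos hA)
  rw [← lintegral_indicator (measurableSet_solidSimplex _)]
  have key : ∀ᵐ x : Fin n → ℝ, (solidSimplex (n + 1)).indicator
      (fun x => ENNReal.ofReal (∏ j, simplexCoord (n + 1) x j ^ (β j - 1))) x =
      ENNReal.ofReal (∏ j, Real.Gamma (β j)) *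
        ((∏ i : Fin n, rieszKernel (β i.castSucc) (x i)) *
          rieszKernel (β (Fin.last n)) (1 - ∑ i, x i)) := by
    filter_upwards [hpos] with x hx
    by_cases hmem : x ∈ solidSimplex (n + 1)
    · have hx' := hx hmem
      simp only [simplexCoord_succ] at hx'
      have hi : ∀ i : Fin n, 0 < x i := fun i => by simpa using hx' i.castSucc
      have hl : 0 < 1 - ∑ i, x i := by simpa using hx' (Fin.last n)
      simp only [Set.indicator_of_mem hmem, simplexCoord_succ, Fin.prod_univ_castSucc,
        Fin.snoc_castSucc, Fin.snoc_last, rieszKernel_of_pos (hi _), rieszKernel_of_pos hl]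
      rw [← ENNReal.ofReal_prod_of_nonneg fun i _ =>
          div_nonneg (Real.rpow_nonneg (hi i).le _) (hΓ _).le,
        ← ENNReal.ofReal_mul (Finset.prod_nonneg fun i _ =>
          div_nonneg (Real.rpow_nonneg (hi i).le _) (hΓ _).le),
        ← ENNReal.ofReal_mul (by simpa only [Fin.prod_univ_castSucc] using hP),
        Finset.prod_div_distrib]
      have h1 : ∏ i : Fin n, Real.Gamma (β i.castSucc) ≠ 0 :=
        Finset.prod_ne_zero_iff.2 fun i _ => (hΓ _).ne'
      have h2 := (hΓ (Fin.last n)).ne'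
      congr 1
      field_simp
    · rw [Set.indicator_of_notMem hmem]
      by_cases h0 : ∀ i, 0 ≤ x i
      · have : ¬ ∑ i, x i ≤ 1 := fun h => hmem ⟨h0, h⟩
        rw [rieszKernel_of_nonpos (show 1 - ∑ i, x i ≤ 0 by linarith)]
        simp
      · push Not at h0
        obtain ⟨i, hi⟩ := h0
        rw [Finset.prod_eq_zero (Finset.mem_univ i) (rieszKernel_of_nonpos hi.le)]
        simp
  have hl := lintegral_prod_rieszKernel (fun i : Fin n => β i.castSucc) (fun _ => hβ _)
    (hβ (Fin.last n)) 1
  refine (lintegral_congr_ae key).trans ?_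
  rw [lintegral_const_mul' _ _ ENNReal.ofReal_ne_top]
  refine (congrArg _ hl).trans ?_
  rw [← Fin.sum_univ_castSucc, rieszKernel_of_pos one_pos, ← ENNReal.ofReal_mul hP,
    Real.one_rpow, mul_one_div, multivariateBeta]

lemma analyticAt_log_Gamma {x : ℝ} (hx : 0 < x) :
    AnalyticAt ℝ (fun y => Real.log (Real.Gamma y)) x := by
  have h : AnalyticAt ℂ Complex.Gamma (x : ℂ) := by
    refine DifferentiableOn.analyticAt (s := {z : ℂ | 0 < z.re}) (fun z hz => ?_)
      ((isOpen_lt continuous_const Complex.continuous_re).mem_nhds (by simpa using hx))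
    refine (Complex.differentiableAt_Gamma z fun m hm => ?_).differentiableWithinAt
    have hz' : 0 < z.re := hz
    rw [hm] at hz'
    have : (0 : ℝ) ≤ m := m.cast_nonneg
    simp at hz'
    linarith
  exact h.re_ofReal.log (Real.Gamma_pos_of_pos hx)

lemma hasDerivAt_log_Gamma {x : ℝ} (hx : 0 < x) :
    HasDerivAt (fun y => Real.log (Real.Gamma y)) (digamma x) x :=
  (analyticAt_log_Gamma hx).differentiableAt.hasDerivAt

lemma hasDerivAt_digamma {x : ℝ} (hx : 0 < x) : HasDerivAt digamma (trigamma x) x :=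
  (analyticAt_log_Gamma hx).deriv.differentiableAt.hasDerivAt

lemma add_single_pos {ι : Type*} [DecidableEq ι] {β : ι → ℝ} (hβ : ∀ j, 0 < β j) (i j : ι) :
    0 < (β + Pi.single i 1 : ι → ℝ) j := by
  have h : (0 : ι → ℝ) ≤ Pi.single i 1 := Pi.single_nonneg.2 zero_le_one
  exact add_pos_of_pos_of_nonneg (hβ j) (h j)

section

variable {ι : Type*} [Fintype ι]

lemma multivariateBeta_pos [Nonempty ι] {β : ι → ℝ} (hβ : ∀ j, 0 < β j) :
    0 < multivariateBeta β :=
  div_pos (Finset.prod_pos fun j _ => Real.Gamma_pos_of_pos (hβ j))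
    (Real.Gamma_pos_of_pos (Finset.sum_pos (fun j _ => hβ j) Finset.univ_nonempty))

lemma sum_add_single [DecidableEq ι] (β : ι → ℝ) (i : ι) :
    ∑ j, (β + Pi.single i 1 : ι → ℝ) j = ∑ j, β j + 1 := by
  simp [Finset.sum_add_distrib]

lemma multivariateBeta_add_single [Nonempty ι] [DecidableEq ι] {β : ι → ℝ} (hβ : ∀ j, 0 < β j)
    (i : ι) :
    multivariateBeta (β + Pi.single i 1) = β i / (∑ j, β j) * multivariateBeta β := by
  have hS : 0 < ∑ j, β j := Finset.sum_pos (fun j _ => hβ j) Finset.univ_nonempty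
  have h1 : ∏ j, Real.Gamma ((β + Pi.single i 1 : ι → ℝ) j) = β i * ∏ j, Real.Gamma (β j) := by
    rw [← Finset.mul_prod_erase _ _ (Finset.mem_univ i),
      ← Finset.mul_prod_erase _ (fun j => Real.Gamma (β j)) (Finset.mem_univ i), ← mul_assoc]
    congr 1
    · simp [Real.Gamma_add_one (hβ i).ne']
    · refine Finset.prod_congr rfl fun j hj => ?_
      simp [Pi.single_eq_of_ne (Finset.ne_of_mem_erase hj)]
  rw [multivariateBeta, h1, sum_add_single, Real.Gamma_add_one hS.ne', multivariateBeta]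
  ring

lemma eventually_add_smul_pos {β : ι → ℝ} (hβ : ∀ j, 0 < β j) (t : ι → ℝ) :
    ∀ᶠ s : ℝ in nhds 0, ∀ j, 0 < (β + s • t) j := by
  refine Filter.eventually_all.2 fun j => ?_
  have h : Continuous fun s : ℝ => (β + s • t) j := by
    simp only [Pi.add_apply, Pi.smul_apply, smul_eq_mul]
    fun_prop
  exact h.continuousAt.eventually_const_lt (by simpa using hβ j)

/-- The second derivative of the multivariate beta function along the direction `t`. -/
lemma iteratedDeriv_two_multivariateBeta [Nonempty ι] {β : ι → ℝ} (hβ : ∀ j, 0 < β j)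
    (t : ι → ℝ) :
    iteratedDeriv 2 (fun s : ℝ => multivariateBeta (β + s • t)) 0 = multivariateBeta β *
      ((∑ j, t j * (digamma (β j) - digamma (∑ j, β j))) ^ 2 +
        ∑ j, t j ^ 2 * trigamma (β j) - (∑ j, t j) ^ 2 * trigamma (∑ j, β j)) := by
  set L : ℝ → ℝ := fun s => ∑ j, Real.log (Real.Gamma (β j + s * t j)) -
    Real.log (Real.Gamma (∑ j, β j + s * ∑ j, t j)) with hL
  set L' : ℝ → ℝ := fun s => ∑ j, digamma (β j + s * t j) * t j -
    digamma (∑ j, β j + s * ∑ j, t j) * ∑ j, t j with hL'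
  have hsum : ∀ s : ℝ, ∑ j, (β j + s * t j) = ∑ j, β j + s * ∑ j, t j := fun s => by
    rw [Finset.sum_add_distrib, Finset.mul_sum]
  have hlin : ∀ a b s : ℝ, HasDerivAt (fun s => a + s * b) b s := fun a b s => by
    simpa using ((hasDerivAt_id s).mul_const b).const_add a
  have hev := eventually_add_smul_pos hβ t
  simp only [Pi.add_apply, Pi.smul_apply, smul_eq_mul] at hev
  have hS : ∀ {s : ℝ}, (∀ j, 0 < β j + s * t j) → 0 < ∑ j, β j + s * ∑ j, t j := fun h => by
    rw [← hsum]
    exact Finset.sum_pos (fun j _ => h j) Finset.univ_nonempty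
  have hexp : (fun s : ℝ => multivariateBeta (β + s • t)) =ᶠ[nhds 0] fun s => Real.exp (L s) := by
    filter_upwards [hev] with s hs
    have hΓ : ∀ j, Real.Gamma (β j + s * t j) ≠ 0 := fun j => (Real.Gamma_pos_of_pos (hs j)).ne'
    simp only [hL]
    rw [← Real.log_prod fun j _ => hΓ j,
      ← Real.log_div (Finset.prod_ne_zero_iff.2 fun j _ => hΓ j)
        (Real.Gamma_pos_of_pos (hS hs)).ne', ← hsum]
    refine (Real.exp_log (multivariateBeta_pos (β := fun j => β j + s * t j) hs)).symm
  have hL1 : ∀ᶠ s in nhds (0 : ℝ), HasDerivAt L (L' s) s := by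
    filter_upwards [hev] with s hs
    exact (HasDerivAt.fun_sum fun j _ =>
      (hasDerivAt_log_Gamma (hs j)).comp s (hlin (β j) (t j) s)).sub
        ((hasDerivAt_log_Gamma (hS hs)).comp s (hlin _ _ s))
  have h0 := hev.self_of_nhds
  have hL2 : HasDerivAt L' (∑ j, t j ^ 2 * trigamma (β j) -
      (∑ j, t j) ^ 2 * trigamma (∑ j, β j)) 0 := by
    have := (HasDerivAt.fun_sum (u := Finset.univ) fun j _ =>
      ((hasDerivAt_digamma (h0 j)).comp 0 (hlin (β j) (t j) 0)).mul_const (t j)).sub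
        (((hasDerivAt_digamma (hS h0)).comp 0 (hlin (∑ j, β j) (∑ j, t j) 0)).mul_const
          (∑ j, t j))
    convert! this using 1
    simp only [zero_mul, add_zero]
    congr 1
    · exact Finset.sum_congr rfl fun j _ => by ring
    · ring
  have hd : deriv (fun s => Real.exp (L s)) =ᶠ[nhds 0] fun s => Real.exp (L s) * L' s :=
    hL1.mono fun s hs => hs.exp.deriv
  rw [hexp.iteratedDeriv_eq, iteratedDeriv_succ, iteratedDeriv_one, hd.deriv_eq,
    (hL1.self_of_nhds.exp.fun_mul hL2).deriv, ← show _ = Real.exp (L 0) from hexp.self_of_nhds]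
  have hL0 : L' 0 = ∑ j, t j * (digamma (β j) - digamma (∑ j, β j)) := by
    simp only [hL', zero_mul, add_zero, mul_sub, Finset.sum_sub_distrib, ← Finset.sum_mul]
    rw [mul_comm (∑ j, t j)]
    simp only [mul_comm]
  rw [hL0]
  simp only [zero_smul, add_zero]
  ring

end

/-- A family of positive functions whose power products integrate to the multivariate beta function,
as the coordinates of the solid simplex do. -/
structure IsDirichletFamily {Ω ι : Type*} [MeasurableSpace Ω] [Fintype ι] (ν : Measure Ω)
    (P : ι → Ω → ℝ) : Prop where
  measurable : ∀ j, Measurable (P j)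
  pos : ∀ᵐ ω ∂ν, ∀ j, 0 < P j ω
  lintegral_eq : ∀ β : ι → ℝ, (∀ j, 0 < β j) →
    ∫⁻ ω, ENNReal.ofReal (∏ j, P j ω ^ (β j - 1)) ∂ν = ENNReal.ofReal (multivariateBeta β)

namespace IsDirichletFamily

variable {Ω ι : Type*} [MeasurableSpace Ω] [Fintype ι] {ν : Measure Ω} {P : ι → Ω → ℝ}

lemma ae_prod_nonneg (h : IsDirichletFamily ν P) (β : ι → ℝ) :
    ∀ᵐ ω ∂ν, 0 ≤ ∏ j, P j ω ^ (β j - 1) := by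
  filter_upwards [h.pos] with ω hω
  exact Finset.prod_nonneg fun j _ => Real.rpow_nonneg (hω j).le _

lemma measurable_prod (h : IsDirichletFamily ν P) (β : ι → ℝ) :
    Measurable fun ω => ∏ j, P j ω ^ (β j - 1) :=
  Finset.measurable_fun_prod _ fun j _ => (h.measurable j).pow_const _

lemma integrable (h : IsDirichletFamily ν P) {β : ι → ℝ} (hβ : ∀ j, 0 < β j) :
    Integrable (fun ω => ∏ j, P j ω ^ (β j - 1)) ν := by
  refine ⟨(h.measurable_prod β).aestronglyMeasurable, ?_⟩
  rw [hasFiniteIntegral_iff_ofReal (h.ae_prod_nonneg β), h.lintegral_eq β hβ]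
  exact ENNReal.ofReal_lt_top

lemma integral_eq [Nonempty ι] (h : IsDirichletFamily ν P) {β : ι → ℝ} (hβ : ∀ j, 0 < β j) :
    ∫ ω, ∏ j, P j ω ^ (β j - 1) ∂ν = multivariateBeta β := by
  rw [integral_eq_lintegral_of_nonneg_ae (h.ae_prod_nonneg β)
    (h.measurable_prod β).aestronglyMeasurable, h.lintegral_eq β hβ,
    ENNReal.toReal_ofReal (multivariateBeta_pos hβ).le]

/-- The (unnormalised) Dirichlet measure with parameter `β`. -/
noncomputable def weighted (ν : Measure Ω) (P : ι → Ω → ℝ) (β : ι → ℝ) : Measure Ω :=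
  ν.withDensity fun ω => ENNReal.ofReal (∏ j, P j ω ^ (β j - 1))

lemma toReal_smul_ae_eq (h : IsDirichletFamily ν P) (β : ι → ℝ) (f : Ω → ℝ) :
    (fun ω => (ENNReal.ofReal (∏ j, P j ω ^ (β j - 1))).toReal • f ω) =ᵐ[ν]
      fun ω => f ω * ∏ j, P j ω ^ (β j - 1) := by
  filter_upwards [h.ae_prod_nonneg β] with ω hω
  rw [ENNReal.toReal_ofReal hω, smul_eq_mul, mul_comm]

lemma integral_weighted (h : IsDirichletFamily ν P) (β : ι → ℝ) (f : Ω → ℝ) :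
    ∫ ω, f ω ∂weighted ν P β = ∫ ω, f ω * ∏ j, P j ω ^ (β j - 1) ∂ν := by
  rw [weighted, integral_withDensity_eq_integral_toReal_smul (h.measurable_prod β).ennreal_ofReal
    (.of_forall fun _ => ENNReal.ofReal_lt_top)]
  exact integral_congr_ae (h.toReal_smul_ae_eq β f)

lemma integrable_weighted_iff (h : IsDirichletFamily ν P) (β : ι → ℝ) (f : Ω → ℝ) :
    Integrable f (weighted ν P β) ↔ Integrable (fun ω => f ω * ∏ j, P j ω ^ (β j - 1)) ν := by
  rw [weighted, integrable_withDensity_iff_integrable_smul' (h.measurable_prod β).ennreal_ofReal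
    (.of_forall fun _ => ENNReal.ofReal_lt_top)]
  exact integrable_congr (h.toReal_smul_ae_eq β f)

lemma exp_mul_prod_ae_eq (h : IsDirichletFamily ν P) (β t : ι → ℝ) (s : ℝ) :
    (fun ω => Real.exp (s * ∑ j, t j * Real.log (P j ω)) * ∏ j, P j ω ^ (β j - 1)) =ᵐ[ν]
      fun ω => ∏ j, P j ω ^ ((β + s • t) j - 1) := by
  filter_upwards [h.pos] with ω hω
  rw [Finset.mul_sum, Real.exp_sum, ← Finset.prod_mul_distrib]
  refine Finset.prod_congr rfl fun j _ => ?_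
  simp only [Real.rpow_def_of_pos (hω j), ← Real.exp_add, Pi.add_apply, Pi.smul_apply, smul_eq_mul]
  ring_nf

lemma zero_mem_interior_integrableExpSet (h : IsDirichletFamily ν P) {β : ι → ℝ}
    (hβ : ∀ j, 0 < β j) (t : ι → ℝ) :
    0 ∈ interior (ProbabilityTheory.integrableExpSet (fun ω => ∑ j, t j * Real.log (P j ω))
      (weighted ν P β)) := by
  rw [mem_interior_iff_mem_nhds]
  filter_upwards [eventually_add_smul_pos hβ t] with s hs
  exact (h.integrable_weighted_iff β _).2
    ((integrable_congr (h.exp_mul_prod_ae_eq β t s)).2 (h.integrable hs))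

lemma mgf_eventuallyEq [Nonempty ι] (h : IsDirichletFamily ν P) {β : ι → ℝ} (hβ : ∀ j, 0 < β j)
    (t : ι → ℝ) :
    ProbabilityTheory.mgf (fun ω => ∑ j, t j * Real.log (P j ω)) (weighted ν P β) =ᶠ[nhds 0]
      fun s => multivariateBeta (β + s • t) := by
  filter_upwards [eventually_add_smul_pos hβ t] with s hs
  rw [ProbabilityTheory.mgf, h.integral_weighted, integral_congr_ae (h.exp_mul_prod_ae_eq β t s),
    h.integral_eq hs]

lemma integral_sq [Nonempty ι] (h : IsDirichletFamily ν P) {β : ι → ℝ} (hβ : ∀ j, 0 < β j)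
    (t : ι → ℝ) :
    ∫ ω, (∑ j, t j * Real.log (P j ω)) ^ 2 ∂weighted ν P β = multivariateBeta β *
      ((∑ j, t j * (digamma (β j) - digamma (∑ j, β j))) ^ 2 +
        ∑ j, t j ^ 2 * trigamma (β j) - (∑ j, t j) ^ 2 * trigamma (∑ j, β j)) := by
  rw [← iteratedDeriv_two_multivariateBeta hβ, ← (h.mgf_eventuallyEq hβ t).iteratedDeriv_eq,
    ProbabilityTheory.iteratedDeriv_mgf_zero (h.zero_mem_interior_integrableExpSet hβ t)]
  rfl

lemma memLp_log (h : IsDirichletFamily ν P) {β : ι → ℝ} (hβ : ∀ j, 0 < β j) (i : ι) :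
    MemLp (fun ω => Real.log (P i ω)) 2 (weighted ν P β) := by
  classical
  have := ProbabilityTheory.memLp_of_mem_interior_integrableExpSet
    (h.zero_mem_interior_integrableExpSet hβ (Pi.single i 1)) 2
  simpa [Pi.single_apply, ite_mul] using this

lemma integrable_log_mul_log (h : IsDirichletFamily ν P) {β : ι → ℝ} (hβ : ∀ j, 0 < β j)
    (i k : ι) :
    Integrable (fun ω => Real.log (P i ω) * Real.log (P k ω)) (weighted ν P β) :=
  (h.memLp_log hβ i).integrable_mul (h.memLp_log hβ k)

lemma integral_log_mul_log [Nonempty ι] [DecidableEq ι] (h : IsDirichletFamily ν P) {β : ι → ℝ}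
    (hβ : ∀ j, 0 < β j) (i k : ι) :
    ∫ ω, Real.log (P i ω) * Real.log (P k ω) ∂weighted ν P β = multivariateBeta β *
      ((digamma (β i) - digamma (∑ j, β j)) * (digamma (β k) - digamma (∑ j, β j)) +
        (if i = k then trigamma (β i) else 0) - trigamma (∑ j, β j)) := by
  have hi := h.integral_sq hβ (Pi.single i 1)
  have hk := h.integral_sq hβ (Pi.single k 1)
  have hik := h.integral_sq hβ (Pi.single i 1 + Pi.single k 1)
  have hii := h.integrable_log_mul_log hβ i i
  have hkk := h.integrable_log_mul_log hβ k k
  have hint := h.integrable_log_mul_log hβ i k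
  simp only [Pi.single_apply, ite_mul, one_mul, zero_mul, Finset.sum_ite_eq', Finset.mem_univ,
    if_true, ite_pow, one_pow, ne_eq, OfNat.ofNat_ne_zero, not_false_eq_true, zero_pow,
    Pi.add_apply, add_mul, Finset.sum_add_distrib, add_sq, mul_ite, mul_one, mul_zero] at hi hk hik
  simp only [sq] at hi hk hik
  have hint2 : Integrable (fun ω => 2 * Real.log (P i ω) * Real.log (P k ω)) (weighted ν P β) := by
    simpa only [mul_assoc] using hint.const_mul 2
  rw [integral_add (f := fun ω => Real.log (P i ω) * Real.log (P i ω) +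
      2 * Real.log (P i ω) * Real.log (P k ω)) (hii.add hint2) hkk,
    integral_add hii hint2, hi, hk] at hik
  simp only [mul_assoc, integral_const_mul] at hik
  rcases eq_or_ne i k with rfl | hc
  · simp only [if_true] at hik ⊢
    linarith
  · simp only [hc, hc.symm, if_false] at hik ⊢
    linarith

lemma prod_rpow_add_single [DecidableEq ι] {p : ι → ℝ} (hp : ∀ j, 0 < p j) (β : ι → ℝ) (i : ι) :
    ∏ j, p j ^ ((β + Pi.single i 1 : ι → ℝ) j - 1) = p i * ∏ j, p j ^ (β j - 1) := by
  rw [← Finset.mul_prod_erase _ _ (Finset.mem_univ i),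
    ← Finset.mul_prod_erase _ (fun j => p j ^ (β j - 1)) (Finset.mem_univ i), ← mul_assoc]
  congr 1
  · rw [Pi.add_apply, Pi.single_eq_same, add_sub_right_comm, Real.rpow_add_one (hp i).ne', mul_comm]
  · refine Finset.prod_congr rfl fun j hj => ?_
    simp [Pi.single_eq_of_ne (Finset.ne_of_mem_erase hj)]

lemma integral_entropy_sq [Nonempty ι] [DecidableEq ι] (h : IsDirichletFamily ν P) {α : ι → ℝ}
    (hα : ∀ j, 0 < α j) :
    ∫ ω, (-(∑ i, P i ω * Real.log (P i ω))) ^ 2 * ∏ j, P j ω ^ (α j - 1) ∂ν =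
      ∑ i, ∑ k, ∫ ω, Real.log (P i ω) * Real.log (P k ω)
        ∂weighted ν P (α + Pi.single i 1 + Pi.single k 1) := by
  have hint := fun i k => (h.integrable_weighted_iff _ _).1
    (h.integrable_log_mul_log (add_single_pos (add_single_pos hα i) k) i k)
  simp only [h.integral_weighted]
  simp_rw [← integral_finsetSum _ fun k _ => hint _ k]
  rw [← integral_finsetSum _ fun i _ => integrable_finsetSum _ fun k _ => hint i k]
  refine integral_congr_ae ?_
  filter_upwards [h.pos] with ω hω
  simp only [prod_rpow_add_single hω]
  rw [neg_sq, sq, Finset.sum_mul_sum]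
  simp only [Finset.sum_mul]
  exact Finset.sum_congr rfl fun i _ => Finset.sum_congr rfl fun k _ => by ring

end IsDirichletFamily

lemma isDirichletFamily_simplexCoord {A : ℕ} (hA : 2 ≤ A) :
    IsDirichletFamily (volume.restrict (solidSimplex A)) fun i x => simplexCoord A x i where
  measurable := measurable_simplexCoord A
  pos := ae_simplexCoord_pos hA
  lintegral_eq := lintegral_solidSimplex_prod_rpow hA

/-- Second moment of the entropy of a `Dirichlet(α₁,…,α_A)` random vector:
`(1/Z) ∫_{T_A} (−∑ πᵢ log πᵢ)² ∏ πⱼ^{αⱼ−1} dx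
 = ∑_{i≠k} (αᵢαₖ/((Ā+1)Ā)) I_{ik} + ∑ᵢ (αᵢ(αᵢ+1)/((Ā+1)Ā)) Jᵢ`. -/
theorem dirichlet_entropy_second_moment (A : ℕ) (hA : 2 ≤ A) (α : Fin A → ℝ)
    (hα : ∀ i, 0 < α i) :
    (1 / ((∏ j, Real.Gamma (α j)) / Real.Gamma (∑ i, α i))) *
        ∫ x in solidSimplex A,
          (-(∑ i, simplexCoord A x i * Real.log (simplexCoord A x i))) ^ 2 *
            ∏ j, simplexCoord A x j ^ (α j - 1)
      = (∑ i, ∑ k, if i ≠ k then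
            (α i * α k / (((∑ i, α i) + 1) * (∑ i, α i))) *
              ((digamma (α k + 1) - digamma ((∑ i, α i) + 2)) *
                  (digamma (α i + 1) - digamma ((∑ i, α i) + 2))
                - trigamma ((∑ i, α i) + 2))
          else 0)
        + ∑ i, (α i * (α i + 1) / (((∑ i, α i) + 1) * (∑ i, α i))) *
            ((digamma (α i + 2) - digamma ((∑ i, α i) + 2)) ^ 2
              + trigamma (α i + 2) - trigamma ((∑ i, α i) + 2)) := by
  have : Nonempty (Fin A) := ⟨⟨0, by omega⟩⟩
  have hS : 0 < ∑ i, α i := Finset.sum_pos (fun i _ => hα i) Finset.univ_nonempty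
  have hB : 0 < multivariateBeta α := multivariateBeta_pos hα
  have h := isDirichletFamily_simplexCoord hA
  rw [h.integral_entropy_sq hα, Finset.mul_sum, ← Finset.sum_add_distrib]
  refine Finset.sum_congr rfl fun i _ => ?_
  have hdiag : ∀ c : ℝ, (∑ k, if i = k then c else 0) = c := fun c => by simp
  refine Eq.trans ?_ (congrArg (HAdd.hAdd _) (hdiag _))
  rw [Finset.mul_sum, ← Finset.sum_add_distrib]
  refine Finset.sum_congr rfl fun k _ => ?_
  rw [h.integral_log_mul_log (add_single_pos (add_single_pos hα i) k),
    multivariateBeta_add_single (add_single_pos hα i),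
    multivariateBeta_add_single hα, sum_add_single, sum_add_single,
    sum_add_single, add_assoc _ (1 : ℝ) 1, one_add_one_eq_two]
  change 1 / multivariateBeta α * _ = _
  rcases eq_or_ne i k with rfl | hik
  · simp only [Pi.add_apply, Pi.single_eq_same, ne_eq, not_true_eq_false, if_true, if_false,
      add_assoc, one_add_one_eq_two]
    field_simp
    ring
  · simp only [Pi.add_apply, Pi.single_eq_same, Pi.single_eq_of_ne hik, Pi.single_eq_of_ne hik.symm,
      ne_eq, hik, not_false_eq_true, if_true, if_false, add_zero]
    field_simp
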